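/- arXiv:1703.07234 — 2 statements merged into one kernel-verified Lean document; each statement's English description precedes it below -/
import Mathlib

section
/- Let (X,d) be a complete separable metric space, let x̄_n ∈ X for n ∈ ℕ ∪ {∞} with x̄_n → x̄_∞, and let m_n (n ∈ ℕ ∪ {∞}) be nonzero Borel measures on X, finite on bounded sets, satisfying the uniform volume growth bound m_n(B_r(x̄_n)) ≤ c₁·exp(c₂·r²) for all r > 0 and all n, for fixed constants c₁, c₂ > 0. Fix C > c₂ and set z_n := ∫_X exp(−C·d(x,x̄_n)²) dm_n(x). Assume ∫_X f dm_n → ∫_X f dm_∞ for every f ∈ C_bs(X). Then: (1) z_n → z_∞ with 0 < z_n < ∞ for all n ∈ ℕ ∪ {∞}; (2) for every bounded continuous g : X → ℝ, ∫_X g(x)·exp(−C·d(x,x̄_n)²) dm_n(x) → ∫_X g(x)·exp(−C·d(x,x̄_∞)²) dm_∞(x); (3) the Borel probability measures m̃_n := z_n⁻¹·exp(−C·d(·,x̄_n)²)·m_n converge weakly to m̃_∞, i.e. ∫ g dm̃_n → ∫ g dm̃_∞ for every bounded continuous g : X → ℝ. -/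
open MeasureTheory Metric Filter Topology

/-- The Gaussian weight `x ↦ exp(−C·d(x,x̄)²)`. -/
noncomputable def gaussWeight {X : Type*} [MetricSpace X] (C : ℝ) (xbar : X) (x : X) : ℝ :=
  Real.exp (-(C * dist x xbar ^ 2))

/-- The Gaussian-weighted total mass `z = ∫ exp(−C·d(x,x̄)²) dm(x)` (as an extended real). -/
noncomputable def gaussMass {X : Type*} [MetricSpace X] [MeasurableSpace X]
    (m : Measure X) (C : ℝ) (xbar : X) : ENNReal :=
  ∫⁻ x, ENNReal.ofReal (gaussWeight C xbar x) ∂m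

/-- The weighted probability measure `m̃ := z⁻¹·exp(−C·d(·,x̄)²)·m`. -/
noncomputable def gaussTilde {X : Type*} [MetricSpace X] [MeasurableSpace X]
    (m : Measure X) (C : ℝ) (xbar : X) : Measure X :=
  (gaussMass m C xbar)⁻¹ • m.withDensity (fun x => ENNReal.ofReal (gaussWeight C xbar x))

section GaussWeight

variable {X : Type*} [MetricSpace X]

theorem gaussWeight_pos (C : ℝ) (y x : X) : 0 < gaussWeight C y x := Real.exp_pos _

theorem continuous_gaussWeight (C : ℝ) (y : X) : Continuous (gaussWeight C y) := by
  unfold gaussWeight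
  fun_prop

theorem gaussWeight_le_one {C : ℝ} (hC : 0 ≤ C) (y x : X) : gaussWeight C y x ≤ 1 :=
  Real.exp_le_one_iff.2 (neg_nonpos.2 (by positivity))

/-- `t ↦ exp (-t)` is `1`-Lipschitz on the nonnegative reals. -/
theorem abs_exp_neg_sub_exp_neg_le {a b : ℝ} (ha : 0 ≤ a) (hb : 0 ≤ b) :
    |Real.exp (-a) - Real.exp (-b)| ≤ |a - b| := by
  wlog hab : a ≤ b generalizing a b
  · rw [abs_sub_comm, abs_sub_comm a b]
    exact this hb ha (le_of_not_ge hab)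
  rw [abs_of_nonneg (sub_nonneg.2 (Real.exp_le_exp.2 (neg_le_neg hab))),
    abs_of_nonpos (sub_nonpos.2 hab)]
  have h : Real.exp (-b) = Real.exp (-a) * Real.exp (a - b) := by
    rw [← Real.exp_add]
    ring_nf
  have h1 : Real.exp (-a) ≤ 1 := Real.exp_le_one_iff.2 (by linarith)
  have h2 := Real.add_one_le_exp (a - b)
  rw [h]
  nlinarith [Real.exp_pos (-a)]

theorem abs_gaussWeight_sub_le {C : ℝ} (hC : 0 ≤ C) (y z x : X) :
    |gaussWeight C y x - gaussWeight C z x| ≤ C * (dist x y + dist x z) * dist y z := by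
  refine (abs_exp_neg_sub_exp_neg_le (by positivity) (by positivity)).trans ?_
  have h : C * dist x y ^ 2 - C * dist x z ^ 2 =
      C * (dist x y + dist x z) * (dist x y - dist x z) := by ring
  rw [h, abs_mul, abs_of_nonneg (by positivity)]
  gcongr
  rw [dist_comm x y, dist_comm x z]
  exact abs_dist_sub_le y z x

/-- A bound for the integral of `gaussWeight C y` over the shell `k ≤ dist x y < k + 1` under
the volume growth bound `c₁ * exp (c₂ * r ^ 2)`. -/
noncomputable def gaussShellBound (c₁ c₂ C : ℝ) (k : ℕ) : ℝ :=
  Real.exp (-(C * (k : ℝ) ^ 2)) * (c₁ * Real.exp (c₂ * ((k : ℝ) + 1) ^ 2))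

theorem gaussShellBound_nonneg {c₁ : ℝ} (hc₁ : 0 ≤ c₁) (c₂ C : ℝ) (k : ℕ) :
    0 ≤ gaussShellBound c₁ c₂ C k := by
  unfold gaussShellBound
  positivity

theorem summable_gaussShellBound {c₁ c₂ C : ℝ} (hc₁ : 0 ≤ c₁) (hC : c₂ < C) :
    Summable (gaussShellBound c₁ c₂ C) := by
  refine Summable.of_nonneg_of_le (gaussShellBound_nonneg hc₁ c₂ C) (fun k => ?_)
    (Real.summable_exp_neg_nat.mul_left
      (c₁ * Real.exp (c₂ + (2 * c₂ + 1) ^ 2 / (4 * (C - c₂)))))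
  have hd : 0 < C - c₂ := sub_pos.2 hC
  unfold gaussShellBound
  rw [mul_left_comm, mul_assoc, ← Real.exp_add, ← Real.exp_add]
  refine mul_le_mul_of_nonneg_left (Real.exp_le_exp.2 ?_) hc₁
  have h : (2 * c₂ + 1) * (k : ℝ) - (C - c₂) * (k : ℝ) ^ 2 ≤
      (2 * c₂ + 1) ^ 2 / (4 * (C - c₂)) := by
    rw [le_div_iff₀ (by positivity)]
    nlinarith [sq_nonneg (2 * (C - c₂) * (k : ℝ) - (2 * c₂ + 1))]
  linarith

variable [MeasurableSpace X] [BorelSpace X]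

theorem setLIntegral_gaussWeight_le {c₁ c₂ C : ℝ} (hc₁ : 0 ≤ c₁) (hC : c₂ < C) (hC0 : 0 ≤ C)
    {μ : Measure X} {y : X}
    (hμ : ∀ r : ℝ, 0 < r → μ (ball y r) ≤ ENNReal.ofReal (c₁ * Real.exp (c₂ * r ^ 2))) (N : ℕ) :
    ∫⁻ x in {x | (N : ℝ) ≤ dist x y}, ENNReal.ofReal (gaussWeight C y x) ∂μ ≤
      ENNReal.ofReal (∑' k, gaussShellBound c₁ c₂ C (k + N)) := by
  let S : ℕ → Set X := fun k => {x | ((k + N : ℕ) : ℝ) ≤ dist x y} ∩ ball y ((k + N : ℕ) + 1)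
  have hS : {x | (N : ℝ) ≤ dist x y} ⊆ ⋃ k, S k := by
    intro x hx
    have hN : N ≤ ⌊dist x y⌋₊ := Nat.le_floor hx
    refine Set.mem_iUnion.2 ⟨⌊dist x y⌋₊ - N, ?_, ?_⟩
    · simp only [Set.mem_ofPred_eq, Nat.sub_add_cancel hN]
      exact Nat.floor_le dist_nonneg
    · rw [mem_ball, Nat.sub_add_cancel hN]
      exact Nat.lt_floor_add_one _
  have hshell (k : ℕ) : ∫⁻ x in S k, ENNReal.ofReal (gaussWeight C y x) ∂μ ≤
      ENNReal.ofReal (gaussShellBound c₁ c₂ C (k + N)) := by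
    have hmeas : MeasurableSet (S k) :=
      (isClosed_le continuous_const (continuous_id.dist continuous_const)).measurableSet.inter
        measurableSet_ball
    calc ∫⁻ x in S k, ENNReal.ofReal (gaussWeight C y x) ∂μ
        ≤ ∫⁻ _ in S k, ENNReal.ofReal (Real.exp (-(C * ((k + N : ℕ) : ℝ) ^ 2))) ∂μ := by
          refine setLIntegral_mono' hmeas fun x hx => ?_
          refine ENNReal.ofReal_le_ofReal (Real.exp_le_exp.2 (neg_le_neg ?_))
          have h : ((k + N : ℕ) : ℝ) ≤ dist x y := hx.1
          gcongr
      _ = ENNReal.ofReal (Real.exp (-(C * ((k + N : ℕ) : ℝ) ^ 2))) * μ (S k) :=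
          setLIntegral_const _ _
      _ ≤ ENNReal.ofReal (Real.exp (-(C * ((k + N : ℕ) : ℝ) ^ 2))) *
            ENNReal.ofReal (c₁ * Real.exp (c₂ * (((k + N : ℕ) : ℝ) + 1) ^ 2)) := by
          gcongr
          exact (measure_mono Set.inter_subset_right).trans (hμ _ (by positivity))
      _ = ENNReal.ofReal (gaussShellBound c₁ c₂ C (k + N)) := by
          rw [← ENNReal.ofReal_mul (Real.exp_pos _).le, gaussShellBound]
  calc ∫⁻ x in {x | (N : ℝ) ≤ dist x y}, ENNReal.ofReal (gaussWeight C y x) ∂μ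
      ≤ ∫⁻ x in ⋃ k, S k, ENNReal.ofReal (gaussWeight C y x) ∂μ := lintegral_mono_set hS
    _ ≤ ∑' k, ∫⁻ x in S k, ENNReal.ofReal (gaussWeight C y x) ∂μ := lintegral_iUnion_le _ _
    _ ≤ ∑' k, ENNReal.ofReal (gaussShellBound c₁ c₂ C (k + N)) := ENNReal.tsum_le_tsum hshell
    _ = ENNReal.ofReal (∑' k, gaussShellBound c₁ c₂ C (k + N)) :=
        (ENNReal.ofReal_tsum_of_nonneg (fun k => gaussShellBound_nonneg hc₁ c₂ C (k + N))
          ((summable_nat_add_iff N).2 (summable_gaussShellBound hc₁ hC))).symm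

theorem gaussMass_lt_top {c₁ c₂ C : ℝ} (hc₁ : 0 ≤ c₁) (hC : c₂ < C) (hC0 : 0 ≤ C)
    {μ : Measure X} {y : X}
    (hμ : ∀ r : ℝ, 0 < r → μ (ball y r) ≤ ENNReal.ofReal (c₁ * Real.exp (c₂ * r ^ 2))) :
    gaussMass μ C y < ⊤ := by
  have h := setLIntegral_gaussWeight_le hc₁ hC hC0 hμ 0
  have huniv : {x : X | ((0 : ℕ) : ℝ) ≤ dist x y} = Set.univ := by
    ext x
    simp
  rw [huniv, Measure.restrict_univ] at h
  exact h.trans_lt ENNReal.ofReal_lt_top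

theorem gaussMass_pos (C : ℝ) {μ : Measure X} (hμ : μ ≠ 0) (y : X) : 0 < gaussMass μ C y := by
  have hm : Measurable fun x => ENNReal.ofReal (gaussWeight C y x) :=
    (continuous_gaussWeight C y).measurable.ennreal_ofReal
  rw [gaussMass, lintegral_pos_iff_support hm]
  have hs : Function.support (fun x => ENNReal.ofReal (gaussWeight C y x)) = Set.univ := by
    ext x
    simp [gaussWeight_pos]
  rw [hs]
  exact Measure.measure_univ_pos.2 hμ

theorem integrable_gaussWeight {C : ℝ} {μ : Measure X} {y : X} (h : gaussMass μ C y < ⊤) :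
    Integrable (gaussWeight C y) μ :=
  (lintegral_ofReal_ne_top_iff_integrable (continuous_gaussWeight C y).aestronglyMeasurable
    (Eventually.of_forall fun x => (gaussWeight_pos C y x).le)).1 h.ne

theorem integrable_mul_gaussWeight {C : ℝ} {μ : Measure X} {y : X} (h : gaussMass μ C y < ⊤)
    {g : X → ℝ} (hg : Continuous g) {M : ℝ} (hM : ∀ x, |g x| ≤ M) :
    Integrable (fun x => g x * gaussWeight C y x) μ :=
  (integrable_gaussWeight h).bdd_mul hg.aestronglyMeasurable (Eventually.of_forall hM)

theorem gaussMass_toReal (C : ℝ) (μ : Measure X) (y : X) :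
    (gaussMass μ C y).toReal = ∫ x, gaussWeight C y x ∂μ :=
  (integral_eq_lintegral_of_nonneg_ae (Eventually.of_forall fun x => (gaussWeight_pos C y x).le)
    (continuous_gaussWeight C y).aestronglyMeasurable).symm

theorem integral_gaussTilde (C : ℝ) (μ : Measure X) (y : X) (g : X → ℝ) :
    ∫ x, g x ∂(gaussTilde μ C y) =
      (gaussMass μ C y).toReal⁻¹ * ∫ x, g x * gaussWeight C y x ∂μ := by
  rw [gaussTilde, integral_smul_measure, integral_withDensity_eq_integral_toReal_smul
    (continuous_gaussWeight C y).measurable.ennreal_ofReal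
    (Eventually.of_forall fun x => ENNReal.ofReal_lt_top), ENNReal.toReal_inv, smul_eq_mul]
  congr 2 with x
  rw [ENNReal.toReal_ofReal (gaussWeight_pos C y x).le, smul_eq_mul, mul_comm]

/-- A function bounded by `M` and vanishing on `ball y N` has small Gaussian integral. -/
theorem abs_integral_mul_gaussWeight_le {c₁ c₂ C : ℝ} (hc₁ : 0 ≤ c₁) (hC : c₂ < C) (hC0 : 0 ≤ C)
    {μ : Measure X} {y : X}
    (hμ : ∀ r : ℝ, 0 < r → μ (ball y r) ≤ ENNReal.ofReal (c₁ * Real.exp (c₂ * r ^ 2))) {N : ℕ}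
    {g : X → ℝ} {M : ℝ} (hM : ∀ x, |g x| ≤ M) (hM0 : 0 ≤ M)
    (hg : ∀ x, dist x y < N → g x = 0) :
    |∫ x, g x * gaussWeight C y x ∂μ| ≤ M * ∑' k, gaussShellBound c₁ c₂ C (k + N) := by
  let T : Set X := {x | (N : ℝ) ≤ dist x y}
  have hint := integrable_gaussWeight (gaussMass_lt_top hc₁ hC hC0 hμ)
  have hT : ∫ x in T, gaussWeight C y x ∂μ ≤ ∑' k, gaussShellBound c₁ c₂ C (k + N) := by
    rw [integral_eq_lintegral_of_nonneg_ae
      (Eventually.of_forall fun x => (gaussWeight_pos C y x).le)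
      (continuous_gaussWeight C y).aestronglyMeasurable]
    exact ENNReal.toReal_le_of_le_ofReal
      (tsum_nonneg fun k => gaussShellBound_nonneg hc₁ c₂ C (k + N))
      (setLIntegral_gaussWeight_le hc₁ hC hC0 hμ N)
  have hsupp : ∫ x in T, g x * gaussWeight C y x ∂μ = ∫ x, g x * gaussWeight C y x ∂μ :=
    setIntegral_eq_integral_of_forall_compl_eq_zero fun x hx => by
      rw [hg x (not_le.1 hx), zero_mul]
  rw [← hsupp, ← Real.norm_eq_abs]
  calc ‖∫ x in T, g x * gaussWeight C y x ∂μ‖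
      ≤ ∫ x in T, M * gaussWeight C y x ∂μ := by
        refine norm_integral_le_of_norm_le (hint.restrict.const_mul M)
          (Eventually.of_forall fun x => ?_)
        rw [Real.norm_eq_abs, abs_mul, abs_of_pos (gaussWeight_pos C y x)]
        exact mul_le_mul_of_nonneg_right (hM x) (gaussWeight_pos C y x).le
    _ = M * ∫ x in T, gaussWeight C y x ∂μ := integral_const_mul _ _
    _ ≤ _ := mul_le_mul_of_nonneg_left hT hM0

/-- Convergence of the Gaussian integrals of a bounded continuous function of bounded support. -/
theorem tendsto_integral_mul_gaussWeight_of_support_subset {c₁ c₂ C : ℝ} (hC0 : 0 ≤ C)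
    {y : ℕ → X} {z : X} (hy : Tendsto y atTop (𝓝 z)) {μ : ℕ → Measure X} {ν : Measure X}
    (hfin : ∀ n, gaussMass (μ n) C (y n) < ⊤)
    (hμ : ∀ n, ∀ r : ℝ, 0 < r →
      μ n (ball (y n) r) ≤ ENNReal.ofReal (c₁ * Real.exp (c₂ * r ^ 2)))
    (hconv : ∀ f : X → ℝ, Continuous f → (∃ M : ℝ, ∀ x, |f x| ≤ M) →
      Bornology.IsBounded (Function.support f) →
      Tendsto (fun n => ∫ x, f x ∂(μ n)) atTop (𝓝 (∫ x, f x ∂ν)))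
    {f : X → ℝ} (hf : Continuous f) {M : ℝ} (hM : ∀ x, |f x| ≤ M) {R : ℝ} (hR : 0 < R)
    (hsupp : Function.support f ⊆ ball z R) :
    Tendsto (fun n => ∫ x, f x * gaussWeight C (y n) x ∂(μ n)) atTop
      (𝓝 (∫ x, f x * gaussWeight C z x ∂ν)) := by
  have hM0 : 0 ≤ M := (abs_nonneg _).trans (hM z)
  have hfw : Tendsto (fun n => ∫ x, f x * gaussWeight C z x ∂(μ n)) atTop
      (𝓝 (∫ x, f x * gaussWeight C z x ∂ν)) := by
    refine hconv _ (hf.mul (continuous_gaussWeight C z)) ⟨M, fun x => ?_⟩ ?_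
    · rw [abs_mul, abs_of_pos (gaussWeight_pos C z x)]
      exact (mul_le_of_le_one_right (abs_nonneg _) (gaussWeight_le_one hC0 z x)).trans (hM x)
    · exact isBounded_ball.subset ((Function.support_mul_subset_left _ _).trans hsupp)
  have hdist : Tendsto (fun n => dist (y n) z) atTop (𝓝 0) := tendsto_iff_dist_tendsto_zero.1 hy
  have hdiff : Tendsto (fun n => ∫ x, f x * (gaussWeight C (y n) x - gaussWeight C z x) ∂(μ n))
      atTop (𝓝 0) := by
    let V : ℝ := c₁ * Real.exp (c₂ * (R + 1) ^ 2)
    have hbound : Tendsto (fun n => M * (C * (R + 1 + R) * dist (y n) z) *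
        (ENNReal.ofReal V).toReal) atTop (𝓝 0) := by
      simpa using ((hdist.const_mul (C * (R + 1 + R))).const_mul M).mul_const
        (ENNReal.ofReal V).toReal
    refine squeeze_zero_norm' ?_ hbound
    filter_upwards [hdist.eventually_lt_const one_pos] with n hn
    have hsub : ball z R ⊆ ball (y n) (R + 1) :=
      ball_subset_ball' (by rw [dist_comm]; linarith)
    have hvol : μ n (ball z R) ≤ ENNReal.ofReal V :=
      (measure_mono hsub).trans (hμ n _ (by positivity))
    have hset : ∫ x in ball z R, f x * (gaussWeight C (y n) x - gaussWeight C z x) ∂(μ n) =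
        ∫ x, f x * (gaussWeight C (y n) x - gaussWeight C z x) ∂(μ n) :=
      setIntegral_eq_integral_of_forall_compl_eq_zero fun x hx => by
        rw [Function.notMem_support.1 fun h => hx (hsupp h), zero_mul]
    rw [← hset]
    refine (norm_setIntegral_le_of_norm_le_const (C := M * (C * (R + 1 + R) * dist (y n) z))
      (hvol.trans_lt ENNReal.ofReal_lt_top) fun x hx => ?_).trans ?_
    · rw [Real.norm_eq_abs, abs_mul]
      refine mul_le_mul (hM x) ((abs_gaussWeight_sub_le hC0 _ _ _).trans ?_) (abs_nonneg _) hM0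
      have h1 : dist x (y n) ≤ R + 1 := (mem_ball.1 (hsub hx)).le
      have h2 : dist x z ≤ R := (mem_ball.1 hx).le
      gcongr
    · gcongr
      exact ENNReal.toReal_mono ENNReal.ofReal_ne_top hvol
  have hsum := hdiff.add hfw
  rw [zero_add] at hsum
  refine hsum.congr' ?_
  filter_upwards [hdist.eventually_lt_const one_pos] with n hn
  have hvol : μ n (ball z R) < ⊤ :=
    (measure_mono (ball_subset_ball' (by rw [dist_comm]; linarith))).trans_lt
      ((hμ n (R + 1) (by positivity)).trans_lt ENNReal.ofReal_lt_top)
  have hintz : Integrable (fun x => f x * gaussWeight C z x) (μ n) := by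
    rw [← integrableOn_iff_integrable_of_support_subset
      ((Function.support_mul_subset_left _ _).trans hsupp)]
    refine IntegrableOn.of_bound hvol
      (hf.mul (continuous_gaussWeight C z)).aestronglyMeasurable M
      (Eventually.of_forall fun x => ?_)
    rw [Real.norm_eq_abs, abs_mul, abs_of_pos (gaussWeight_pos C z x)]
    exact (mul_le_of_le_one_right (abs_nonneg _) (gaussWeight_le_one hC0 z x)).trans (hM x)
  have hinty := integrable_mul_gaussWeight (hfin n) hf hM
  simp_rw [mul_sub]
  rw [integral_sub hinty hintz]
  ring

/-- Convergence of the Gaussian integrals of a bounded continuous function. -/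
theorem tendsto_integral_mul_gaussWeight {c₁ c₂ C : ℝ} (hc₁ : 0 ≤ c₁) (hC : c₂ < C) (hC0 : 0 ≤ C)
    {y : ℕ → X} {z : X} (hy : Tendsto y atTop (𝓝 z)) {μ : ℕ → Measure X} {ν : Measure X}
    (hμ : ∀ n, ∀ r : ℝ, 0 < r →
      μ n (ball (y n) r) ≤ ENNReal.ofReal (c₁ * Real.exp (c₂ * r ^ 2)))
    (hν : ∀ r : ℝ, 0 < r → ν (ball z r) ≤ ENNReal.ofReal (c₁ * Real.exp (c₂ * r ^ 2)))
    (hconv : ∀ f : X → ℝ, Continuous f → (∃ M : ℝ, ∀ x, |f x| ≤ M) →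
      Bornology.IsBounded (Function.support f) →
      Tendsto (fun n => ∫ x, f x ∂(μ n)) atTop (𝓝 (∫ x, f x ∂ν)))
    {g : X → ℝ} (hg : Continuous g) {M : ℝ} (hM : ∀ x, |g x| ≤ M) :
    Tendsto (fun n => ∫ x, g x * gaussWeight C (y n) x ∂(μ n)) atTop
      (𝓝 (∫ x, g x * gaussWeight C z x ∂ν)) := by
  have hM0 : 0 ≤ M := (abs_nonneg _).trans (hM z)
  have hfinμ (n : ℕ) := gaussMass_lt_top hc₁ hC hC0 (hμ n)
  have hfinν := gaussMass_lt_top hc₁ hC hC0 hν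
  refine Metric.tendsto_nhds.2 fun ε hε => ?_
  have htail : Tendsto (fun N => M * ∑' k, gaussShellBound c₁ c₂ C (k + N)) atTop (𝓝 0) := by
    simpa using (tendsto_sum_nat_add (gaussShellBound c₁ c₂ C)).const_mul M
  obtain ⟨N, hN⟩ := (htail.eventually_lt_const (by positivity : 0 < ε / 3)).exists
  let φ : X → ℝ := fun x => max 0 (min 1 ((N : ℝ) + 2 - dist x z))
  have hφ : Continuous φ := by fun_prop
  have hφ0 (x : X) : 0 ≤ φ x := le_max_left _ _
  have hφ1 (x : X) : φ x ≤ 1 := max_le zero_le_one (min_le_left _ _)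
  have hφone (x : X) (hx : dist x z < N + 1) : φ x = 1 := by
    simp only [φ]
    rw [min_eq_left (by linarith), max_eq_right zero_le_one]
  have hφsupp : Function.support φ ⊆ ball z (N + 2) := by
    intro x hx
    by_contra h
    refine hx (max_eq_left ((min_le_right _ _).trans ?_))
    rw [mem_ball, not_lt] at h
    linarith
  have hφg : Continuous fun x => φ x * g x := hφ.mul hg
  have hφg' : Continuous fun x => (1 - φ x) * g x := (continuous_const.sub hφ).mul hg
  have hgφ : ∀ x, |φ x * g x| ≤ M := fun x => by
    rw [abs_mul, abs_of_nonneg (hφ0 x)]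
    exact (mul_le_of_le_one_left (abs_nonneg _) (hφ1 x)).trans (hM x)
  have hgφ' : ∀ x, |(1 - φ x) * g x| ≤ M := fun x => by
    rw [abs_mul, abs_of_nonneg (sub_nonneg.2 (hφ1 x))]
    exact (mul_le_of_le_one_left (abs_nonneg _) (by linarith [hφ0 x])).trans (hM x)
  have hcut := tendsto_integral_mul_gaussWeight_of_support_subset hC0 hy hfinμ hμ hconv
    hφg hgφ (by positivity : (0 : ℝ) < N + 2)
    ((Function.support_mul_subset_left _ _).trans hφsupp)
  have hsplit (ρ : Measure X) (w : X) (hρ : gaussMass ρ C w < ⊤) :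
      ∫ x, g x * gaussWeight C w x ∂ρ = ∫ x, φ x * g x * gaussWeight C w x ∂ρ +
        ∫ x, (1 - φ x) * g x * gaussWeight C w x ∂ρ := by
    rw [← integral_add (integrable_mul_gaussWeight hρ hφg hgφ)
      (integrable_mul_gaussWeight hρ hφg' hgφ')]
    congr 1 with x
    ring
  filter_upwards [hcut.eventually (Metric.ball_mem_nhds _ (by positivity : 0 < ε / 3)),
    hy.eventually (Metric.ball_mem_nhds z one_pos)] with n hn hyn
  have h1 := abs_integral_mul_gaussWeight_le (N := N) hc₁ hC hC0 (hμ n) hgφ' hM0 fun x hx => by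
    rw [hφone x (by linarith [dist_triangle x (y n) z, mem_ball.1 hyn]), sub_self, zero_mul]
  have h2 := abs_integral_mul_gaussWeight_le (N := N) hc₁ hC hC0 hν hgφ' hM0 fun x hx => by
    rw [hφone x (by linarith), sub_self, zero_mul]
  rw [Real.dist_eq] at hn
  rw [hsplit _ _ (hfinμ n), hsplit _ _ hfinν, Real.dist_eq]
  rw [abs_lt] at hn ⊢
  rw [abs_le] at h1 h2
  constructor <;> linarith [h1.1, h1.2, h2.1, h2.2, hn.1, hn.2]

end GaussWeight

/-- If `mₙ → m∞` in duality with bounded continuous functions of bounded support, with base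
points `x̄ₙ → x̄∞` and a uniform Gaussian volume growth bound, then the weighted masses `zₙ`
converge (and are finite and positive), the Gaussian-weighted integrals of bounded continuous
functions converge, and the weighted probability measures `m̃ₙ` converge weakly to `m̃∞`. -/
theorem weighted_measures_converge
    {X : Type*} [MetricSpace X] [CompleteSpace X] [TopologicalSpace.SeparableSpace X]
    [MeasurableSpace X] [BorelSpace X]
    (xbar : ℕ → X) (xinf : X) (hx : Tendsto xbar atTop (𝓝 xinf))
    (m : ℕ → Measure X) (minf : Measure X)
    (hm0 : ∀ n, m n ≠ 0) (hminf0 : minf ≠ 0)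
    (hmfin : ∀ n, ∀ s : Set X, Bornology.IsBounded s → m n s < ⊤)
    (hminffin : ∀ s : Set X, Bornology.IsBounded s → minf s < ⊤)
    (c₁ c₂ : ℝ) (hc₁ : 0 < c₁) (hc₂ : 0 < c₂)
    (hvol : ∀ n, ∀ r : ℝ, 0 < r →
      m n (Metric.ball (xbar n) r) ≤ ENNReal.ofReal (c₁ * Real.exp (c₂ * r ^ 2)))
    (hvolinf : ∀ r : ℝ, 0 < r →
      minf (Metric.ball xinf r) ≤ ENNReal.ofReal (c₁ * Real.exp (c₂ * r ^ 2)))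
    (C : ℝ) (hC : c₂ < C)
    (hconv : ∀ f : X → ℝ, Continuous f → (∃ M : ℝ, ∀ x, |f x| ≤ M) →
      Bornology.IsBounded (Function.support f) →
      Tendsto (fun n => ∫ x, f x ∂(m n)) atTop (𝓝 (∫ x, f x ∂minf))) :
    ((∀ n, 0 < gaussMass (m n) C (xbar n) ∧ gaussMass (m n) C (xbar n) < ⊤) ∧
      (0 < gaussMass minf C xinf ∧ gaussMass minf C xinf < ⊤) ∧
      Tendsto (fun n => (gaussMass (m n) C (xbar n)).toReal) atTop
        (𝓝 ((gaussMass minf C xinf).toReal))) ∧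
    (∀ g : X → ℝ, Continuous g → (∃ M : ℝ, ∀ x, |g x| ≤ M) →
      Tendsto (fun n => ∫ x, g x * gaussWeight C (xbar n) x ∂(m n)) atTop
        (𝓝 (∫ x, g x * gaussWeight C xinf x ∂minf))) ∧
    (∀ g : X → ℝ, Continuous g → (∃ M : ℝ, ∀ x, |g x| ≤ M) →
      Tendsto (fun n => ∫ x, g x ∂(gaussTilde (m n) C (xbar n))) atTop
        (𝓝 (∫ x, g x ∂(gaussTilde minf C xinf)))) := by
  have hC0 : 0 ≤ C := (hc₂.trans hC).le
  have hlim {g : X → ℝ} (hg : Continuous g) (hM : ∃ M : ℝ, ∀ x, |g x| ≤ M) :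
      Tendsto (fun n => ∫ x, g x * gaussWeight C (xbar n) x ∂(m n)) atTop
        (𝓝 (∫ x, g x * gaussWeight C xinf x ∂minf)) :=
    tendsto_integral_mul_gaussWeight hc₁.le hC hC0 hx hvol hvolinf hconv hg hM.choose_spec
  have hpos : 0 < gaussMass minf C xinf := gaussMass_pos C hminf0 xinf
  have hfin : gaussMass minf C xinf < ⊤ := gaussMass_lt_top hc₁.le hC hC0 hvolinf
  have hmass : Tendsto (fun n => (gaussMass (m n) C (xbar n)).toReal) atTop
      (𝓝 ((gaussMass minf C xinf).toReal)) := by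
    simp_rw [gaussMass_toReal]
    simpa using hlim (g := fun _ => 1) continuous_const ⟨1, fun _ => by simp⟩
  refine ⟨⟨fun n => ⟨gaussMass_pos C (hm0 n) _, gaussMass_lt_top hc₁.le hC hC0 (hvol n)⟩,
    ⟨hpos, hfin⟩, hmass⟩, fun g hg hM => hlim hg hM, fun g hg hM => ?_⟩
  simp_rw [integral_gaussTilde]
  exact (hmass.inv₀ (ENNReal.toReal_pos hpos.ne' hfin.ne).ne').mul (hlim hg hM)
end

section
/- Let (X,d) be a metric space and m a Borel measure on X that is finite on bounded sets. Let L, M ≥ 0 and let f_n : X → ℝ (n ∈ ℕ) be functions that are Lipschitz with constant L and satisfy |f_n| ≤ M on X, and let f : X → ℝ be continuous. If ∫_X φ·f_n dm → ∫_X φ·f dm for every φ ∈ C_bs(X), then f_n converges to f uniformly on every compact subset K of supp(m); in particular f_n(x) → f(x) for every x ∈ supp(m). -/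
open MeasureTheory Metric Filter Topology

/-- The support of a Borel measure `m` on a metric space: the set of points all of whose
balls have positive measure. -/
def measSupport {X : Type*} [MetricSpace X] [MeasurableSpace X] (m : Measure X) : Set X :=
  {x : X | ∀ r : ℝ, 0 < r → 0 < m (Metric.ball x r)}

/-- A weighted integral of `g` against a nonnegative weight `φ` differs from `c * ∫ φ` by at most
`δ * ∫ φ` when `g` is within `δ` of `c` wherever `φ` does not vanish. -/
lemma abs_integral_mul_sub_le {α : Type*} [MeasurableSpace α] {μ : Measure α} {φ g : α → ℝ}
    {c δ : ℝ} (hφ : Integrable φ μ) (hφ0 : 0 ≤ φ) (hg : AEStronglyMeasurable g μ)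
    (hgc : ∀ y, φ y ≠ 0 → |g y - c| ≤ δ) :
    |∫ y, φ y * g y ∂μ - c * ∫ y, φ y ∂μ| ≤ δ * ∫ y, φ y ∂μ := by
  have hbound : ∀ y, ‖φ y * (g y - c)‖ ≤ δ * φ y := fun y => by
    rw [norm_mul, Real.norm_eq_abs, Real.norm_eq_abs, abs_of_nonneg (hφ0 y), mul_comm δ]
    by_cases hy : φ y = 0
    · simp [hy]
    · exact mul_le_mul_of_nonneg_left (hgc y hy) (hφ0 y)
  have hint : Integrable (fun y => φ y * (g y - c)) μ :=
    (hφ.const_mul δ).mono' (hφ.1.mul (hg.sub aestronglyMeasurable_const)) (ae_of_all _ hbound)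
  have heq : ∫ y, φ y * g y ∂μ - c * ∫ y, φ y ∂μ = ∫ y, φ y * (g y - c) ∂μ := by
    have hsum : ∀ y, φ y * g y = φ y * (g y - c) + c * φ y := fun y => by ring
    simp_rw [hsum]
    rw [integral_add hint (hφ.const_mul c), integral_const_mul, add_sub_cancel_right]
  rw [heq, ← integral_const_mul, ← Real.norm_eq_abs]
  exact norm_integral_le_of_norm_le (hφ.const_mul δ) (ae_of_all _ hbound)

/-- At a point of `supp m`, for every `r > 0` there is a bounded continuous nonnegative weight
supported in the ball of radius `r`, integrable and of positive integral. -/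
lemma exists_weight_of_mem_measSupport {X : Type*} [MetricSpace X] [MeasurableSpace X]
    [BorelSpace X] {m : Measure X} (hmfin : ∀ s : Set X, Bornology.IsBounded s → m s < ⊤)
    {x : X} (hx : x ∈ measSupport m) {r : ℝ} (hr : 0 < r) :
    ∃ φ : X → ℝ, Continuous φ ∧ (∃ C : ℝ, ∀ y, |φ y| ≤ C) ∧ 0 ≤ φ ∧
      Function.support φ ⊆ ball x r ∧ Integrable φ m ∧ 0 < ∫ y, φ y ∂m := by
  let φ : X → ℝ := fun y => max 0 (r - dist y x)
  have hcont : Continuous φ := by fun_prop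
  have hnonneg : 0 ≤ φ := fun y => le_max_left _ _
  have hle : ∀ y, |φ y| ≤ r := fun y => by
    rw [abs_of_nonneg (hnonneg y)]
    exact max_le hr.le (sub_le_self _ dist_nonneg)
  have hsupp : Function.support φ = ball x r := by
    ext y
    simp [φ, Function.mem_support, mem_ball]
  have hint : Integrable φ m := by
    rw [← integrableOn_iff_integrable_of_support_subset hsupp.le]
    exact Measure.integrableOn_of_bounded (M := r) (hmfin _ isBounded_ball).ne
      hcont.aestronglyMeasurable (ae_of_all _ hle)
  refine ⟨φ, hcont, ⟨r, hle⟩, hnonneg, hsupp.le, hint, ?_⟩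
  rw [integral_pos_iff_support_of_nonneg hnonneg hint, hsupp]
  exact hx r hr

/-- A uniformly Lipschitz, uniformly bounded sequence `fₙ` that converges to a continuous `f`
weakly against bounded continuous functions of bounded support (w.r.t. a Borel measure `m`
finite on bounded sets) converges to `f` uniformly on every compact subset of `supp m`, and
in particular pointwise on `supp m`. -/
theorem lipschitz_weak_implies_locally_uniform
    {X : Type*} [MetricSpace X] [MeasurableSpace X] [BorelSpace X]
    (m : Measure X) (hmfin : ∀ s : Set X, Bornology.IsBounded s → m s < ⊤)
    (L M : ℝ) (hL : 0 ≤ L) (hM : 0 ≤ M)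
    (f : ℕ → X → ℝ) (flim : X → ℝ)
    (hlip : ∀ n, ∀ x y : X, |f n x - f n y| ≤ L * dist x y)
    (hbd : ∀ n, ∀ x : X, |f n x| ≤ M)
    (hcont : Continuous flim)
    (hconv : ∀ φ : X → ℝ, Continuous φ → (∃ Mφ : ℝ, ∀ x, |φ x| ≤ Mφ) →
      Bornology.IsBounded (Function.support φ) →
      Tendsto (fun n => ∫ x, φ x * f n x ∂m) atTop (𝓝 (∫ x, φ x * flim x ∂m))) :
    (∀ K : Set X, K ⊆ measSupport m → IsCompact K →
      TendstoUniformlyOn (fun n => f n) flim atTop K) ∧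
    (∀ x ∈ measSupport m, Tendsto (fun n => f n x) atTop (𝓝 (flim x))) := by
  have hlip' : ∀ n, LipschitzWith (Real.toNNReal L) (f n) := fun n =>
    LipschitzWith.of_dist_le_mul fun x y => by
      rw [Real.dist_eq, Real.coe_toNNReal L hL]
      exact hlip n x y
  have hpt : ∀ x ∈ measSupport m, Tendsto (fun n => f n x) atTop (𝓝 (flim x)) := by
    intro x hx
    rw [Metric.tendsto_nhds]
    intro ε hε
    obtain ⟨ρ, hρ, hflim⟩ := Metric.continuousAt_iff.1 (hcont.continuousAt (x := x)) (ε / 3)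
      (by positivity)
    have hr : 0 < min ρ (ε / 3 / (L + 1)) := by positivity
    obtain ⟨φ, hφc, hφb, hφ0, hφs, hφi, hφpos⟩ := exists_weight_of_mem_measSupport hmfin hx hr
    have hball : ∀ y, φ y ≠ 0 → dist y x < min ρ (ε / 3 / (L + 1)) := fun y hy => hφs hy
    have hlim : |∫ y, φ y * flim y ∂m - flim x * ∫ y, φ y ∂m| ≤ ε / 3 * ∫ y, φ y ∂m :=
      abs_integral_mul_sub_le hφi hφ0 hcont.aestronglyMeasurable fun y hy =>
        (hflim ((hball y hy).trans_le (min_le_left _ _))).le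
    have hfn : ∀ n, |∫ y, φ y * f n y ∂m - f n x * ∫ y, φ y ∂m| ≤ ε / 3 * ∫ y, φ y ∂m :=
      fun n => abs_integral_mul_sub_le hφi hφ0 (hlip' n).continuous.aestronglyMeasurable
        fun y hy => by
          have hy' := (lt_div_iff₀ (by positivity)).1
            ((hball y hy).trans_le (min_le_right _ _))
          have hyx : 0 ≤ dist y x := dist_nonneg
          linarith [hlip n y x]
    filter_upwards [Metric.tendsto_nhds.1
      (hconv φ hφc hφb (isBounded_ball.subset hφs)) (ε / 3 * ∫ y, φ y ∂m) (by positivity)]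
      with n hn
    rw [Real.dist_eq] at hn ⊢
    have hmul : |f n x - flim x| * ∫ y, φ y ∂m < ε * ∫ y, φ y ∂m := by
      rw [← abs_of_pos hφpos, ← abs_mul, abs_of_pos hφpos]
      have h₁ := abs_le.1 (hfn n)
      have h₂ := abs_le.1 hlim
      have h₃ := abs_lt.1 hn
      rw [abs_lt]
      constructor <;> linarith
    exact lt_of_mul_lt_mul_right hmul hφpos.le
  refine ⟨fun K hK hKc => ?_, hpt⟩
  have hequi : Equicontinuous f :=
    (LipschitzWith.uniformEquicontinuous f _ hlip').equicontinuous
  have hunif := (EquicontinuousOn.tendsto_uniformOnFun_iff_pi' (𝔖 := {K}) (by simpa using hKc)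
    (fun K _ => hequi.equicontinuousOn K) atTop flim).2 <| by
      rw [tendsto_pi_nhds]
      rintro ⟨x, hx⟩
      exact hpt x (hK (by simpa using hx))
  exact UniformOnFun.tendsto_iff_tendstoUniformlyOn.1 hunif K rfl
end
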